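/- arXiv:math/0209284 — 6 statements merged into one kernel-verified Lean document; each statement's English description precedes it below -/
import Mathlib

section
/- Let G be a totally ordered abelian monoid and let R ⊆ S be an extension of reduced commutative G-graded rings. Let U denote the set of homogeneous elements of R that are non-zerodivisors on S, and assume that the localization U⁻¹R is integrally closed in U⁻¹S. Then the integral closure of R in S is G-graded; that is, for every element s ∈ S that is integral over R, every homogeneous component of s is integral over R. -/
section GradedTop

open DirectSum

variable {G S : Type*} [AddCommMonoid G] [LinearOrder G] [CommRing S]
  (𝒮 : G → AddSubgroup S) [GradedRing 𝒮]

theorem coe_decompose_mul_eq_sum (a b : S) (n : G)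
    [∀ (i : G) (x : 𝒮 i), Decidable (x ≠ 0)] :
    (decompose 𝒮 (a * b) n : S) =
      ∑ ij ∈ (decompose 𝒮 a).support ×ˢ (decompose 𝒮 b).support with ij.1 + ij.2 = n,
        (decompose 𝒮 a ij.1 * decompose 𝒮 b ij.2 : S) := by
  rw [decompose_mul, coe_mul_apply]

theorem decompose_eq_zero_of_mem_of_lt {a : S} {p : G} (ha : a ∈ 𝒮 p) (j : G) (hj : p < j) :
    decompose 𝒮 a j = 0 :=
  Subtype.ext (decompose_of_mem_ne 𝒮 ha hj.ne)

theorem decompose_mem_subringClosure {T : Set S} (hT : ∀ t ∈ T, SetLike.IsHomogeneousElem 𝒮 t)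
    {r : S} (hr : r ∈ Subring.closure T) (g : G) :
    (decompose 𝒮 r g : S) ∈ Subring.closure T := by
  classical
  have of_mem {x : S} {i : G} (hx : x ∈ Subring.closure T) (hi : x ∈ 𝒮 i) (g : G) :
      (decompose 𝒮 x g : S) ∈ Subring.closure T := by
    by_cases h : i = g
    · subst h
      rwa [decompose_of_mem_same 𝒮 hi]
    · rw [decompose_of_mem_ne 𝒮 hi h]
      exact zero_mem _
  induction hr using Subring.closure_induction generalizing g with
  | mem x hx =>
    obtain ⟨i, hi⟩ := hT x hx
    exact of_mem (Subring.subset_closure hx) hi g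
  | zero => simp
  | one => exact of_mem (one_mem _) SetLike.GradedOne.one_mem g
  | add x y _ _ hx hy => simpa using add_mem (hx g) (hy g)
  | neg x _ hx =>
    rw [decompose_neg]
    exact neg_mem (hx g)
  | mul x y _ _ hx hy =>
    rw [coe_decompose_mul_eq_sum]
    exact sum_mem fun ij _ => mul_mem (hx _) (hy _)

variable [IsOrderedCancelAddMonoid G]

theorem decompose_mul_eq_zero_of_add_lt {a b : S} {p q : G}
    (ha : ∀ j, p < j → decompose 𝒮 a j = 0) (hb : ∀ j, q < j → decompose 𝒮 b j = 0)
    (j : G) (hj : p + q < j) : decompose 𝒮 (a * b) j = 0 := by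
  classical
  refine Subtype.ext ?_
  rw [coe_decompose_mul_eq_sum, Finset.sum_eq_zero, ZeroMemClass.coe_zero]
  rintro ⟨k, l⟩ hkl
  obtain rfl := (Finset.mem_filter.mp hkl).2
  by_cases hk : p < k
  · simp [ha k hk]
  · by_cases hl : q < l
    · simp [hb l hl]
    · exact absurd hj (not_lt.mpr (add_le_add (not_lt.mp hk) (not_lt.mp hl)))

theorem coe_decompose_mul_add_of_top {a b : S} {p q : G}
    (ha : ∀ j, p < j → decompose 𝒮 a j = 0) (hb : ∀ j, q < j → decompose 𝒮 b j = 0) :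
    (decompose 𝒮 (a * b) (p + q) : S) = decompose 𝒮 a p * decompose 𝒮 b q := by
  classical
  rw [coe_decompose_mul_eq_sum, Finset.sum_eq_single (p, q)]
  · rintro ⟨k, l⟩ hkl hne
    by_cases hk : p < k
    · simp [ha k hk]
    · by_cases hl : q < l
      · simp [hb l hl]
      · obtain ⟨rfl, rfl⟩ := (add_eq_add_iff_eq_and_eq (not_lt.mp hk) (not_lt.mp hl)).mp
          (Finset.mem_filter.mp hkl).2
        exact absurd rfl hne
  · intro h
    simp only [Finset.mem_filter, Finset.mem_product, DFinsupp.mem_support_toFun, and_true,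
      not_and_or, not_not] at h
    rcases h with h | h <;> simp [h]

theorem exists_coe_decompose_pow_eq_pow {a : S} {p : G}
    (ha : ∀ j, p < j → decompose 𝒮 a j = 0) (k : ℕ) :
    ∃ q, (∀ j, q < j → decompose 𝒮 (a ^ k) j = 0) ∧
      (decompose 𝒮 (a ^ k) q : S) = (decompose 𝒮 a p : S) ^ k := by
  induction k with
  | zero =>
    have h1 : (1 : S) ∈ 𝒮 0 := SetLike.GradedOne.one_mem
    simp only [pow_zero]
    exact ⟨0, decompose_eq_zero_of_mem_of_lt 𝒮 h1, decompose_of_mem_same 𝒮 h1⟩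
  | succ k ih =>
    obtain ⟨q, hq, hqk⟩ := ih
    simp only [pow_succ]
    exact ⟨q + p, decompose_mul_eq_zero_of_add_lt 𝒮 hq ha,
      by rw [coe_decompose_mul_add_of_top 𝒮 hq ha, hqk]⟩

theorem coe_decompose_mul_of_mem_add {a b : S} {p : G} (ha : a ∈ 𝒮 p) (q : G) :
    (decompose 𝒮 (a * b) (p + q) : S) = a * decompose 𝒮 b q := by
  classical
  lift a to 𝒮 p using ha
  rw [decompose_mul, decompose_coe]
  exact coe_of_mul_apply_aux _ _ _ fun x => add_right_inj p

end GradedTop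

section Integral

variable {S : Type*} [CommRing S]

theorem IsIntegral.exists_pow_mul_pow_mem {A : Subring S} {u s : S} (hs : IsIntegral A s)
    (hu : u ∈ A) (hus : u * s ∈ A) : ∃ n : ℕ, ∀ k, u ^ n * s ^ k ∈ A := by
  obtain ⟨p, hp, hps⟩ := hs
  refine ⟨p.natDegree, fun k => ?_⟩
  induction k using Nat.strong_induction_on with | h k IH =>
  obtain hk | hk := lt_or_ge k p.natDegree
  · rw [← Nat.sub_add_cancel hk.le, pow_add, mul_assoc, ← mul_pow]
    exact mul_mem (pow_mem hu _) (pow_mem hus _)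
  · rw [Polynomial.eval₂_eq_sum_range, Finset.sum_range_succ, Polynomial.coeff_natDegree,
      hp.leadingCoeff, map_one, one_mul, add_eq_zero_iff_eq_neg'] at hps
    rw [← Nat.sub_add_cancel hk, pow_add s, hps, mul_neg, mul_neg, Finset.mul_sum,
      Finset.mul_sum]
    refine neg_mem (sum_mem fun i hi => ?_)
    have hi' := Finset.mem_range.mp hi
    have h := mul_mem (p.coeff i).2 (IH (k - p.natDegree + i) (by lia))
    rw [pow_add s] at h
    convert h using 1
    change _ * (_ * ((p.coeff i : S) * _)) = _
    ring

theorem isIntegral_of_mul_pow_mem {A : Subring S} [IsNoetherianRing A] {d t : S}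
    (hd : ∀ x : S, d * x = 0 → x = 0) (h : ∀ k, d * t ^ k ∈ A) : IsIntegral A t := by
  let N : Submodule A S := LinearMap.range (Algebra.linearMap A S)
  let f : Algebra.adjoin A {t} →ₗ[A] N :=
    (LinearMap.mulLeft A d).restrict (p := (Algebra.adjoin A {t}).toSubmodule) <| by
      change (Algebra.adjoin A {t}).toSubmodule ≤ N.comap _
      rw [Algebra.adjoin_eq_span, ← Submonoid.powers_eq_closure, Submodule.span_le]
      rintro _ ⟨k, rfl⟩
      exact ⟨⟨_, h k⟩, rfl⟩
  have hf : Function.Injective f := by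
    rw [injective_iff_map_eq_zero]
    exact fun x hx => Subtype.ext (hd x (congrArg Subtype.val hx))
  have : (Algebra.adjoin A {t}).toSubmodule.FG := by
    rw [← Module.Finite.iff_fg]
    exact .of_injective f hf
  exact .of_mem_of_fg _ this _ (Algebra.self_mem_adjoin_singleton A t)

theorem IsIntegral.of_subring_le {A B : Subring S} (hAB : A ≤ B) {s : S} (hs : IsIntegral A s) :
    IsIntegral B s :=
  hs.map_of_comp_eq (Subring.inclusion hAB) (RingHom.id S) rfl

end Integral

section Graded

open DirectSum

variable {G S : Type*} [AddCommMonoid G] [LinearOrder G] [IsOrderedCancelAddMonoid G] [CommRing S]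
  (𝒮 : G → AddSubgroup S) [GradedRing 𝒮]

theorem isIntegral_decompose_top {A : Subring S} [IsNoetherianRing A]
    (hA : ∀ r ∈ A, ∀ g, (decompose 𝒮 r g : S) ∈ A) {u : S} {e : G} (hue : u ∈ 𝒮 e)
    (hu : u ∈ A) (hu0 : ∀ x : S, u * x = 0 → x = 0) {s : S} (hs : IsIntegral A s)
    (hus : u * s ∈ A) {g : G} (hg : ∀ j, g < j → decompose 𝒮 s j = 0) :
    IsIntegral A (decompose 𝒮 s g : S) := by
  obtain ⟨n, hn⟩ := hs.exists_pow_mul_pow_mem hu hus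
  refine isIntegral_of_mul_pow_mem (d := u ^ n) (fun x hx => ?_) fun k => ?_
  · clear hn
    induction n with
    | zero => simpa using hx
    | succ n ih => exact ih (hu0 _ (by rw [← mul_assoc, ← pow_succ', hx]))
  · obtain ⟨q, -, hq⟩ := exists_coe_decompose_pow_eq_pow 𝒮 hg k
    rw [← hq, ← coe_decompose_mul_of_mem_add 𝒮 (SetLike.pow_mem_graded n hue)]
    exact hA _ (hn k) _

theorem isIntegral_decompose_of_isNoetherianRing {A : Subring S} [IsNoetherianRing A]
    (hA : ∀ r ∈ A, ∀ g, (decompose 𝒮 r g : S) ∈ A) {u : S} {e : G} (hue : u ∈ 𝒮 e)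
    (hu : u ∈ A) (hu0 : ∀ x : S, u * x = 0 → x = 0) {s : S} (hs : IsIntegral A s)
    (hus : u * s ∈ A) (g : G) : IsIntegral A (decompose 𝒮 s g : S) := by
  classical
  induction hc : (decompose 𝒮 s).support.card using Nat.strong_induction_on
    generalizing s with | h c IH =>
  by_cases hsupp : (decompose 𝒮 s).support.Nonempty
  · set m := (decompose 𝒮 s).support.max' hsupp
    have hm : m ∈ (decompose 𝒮 s).support := Finset.max'_mem _ _
    have htop : ∀ j, m < j → decompose 𝒮 s j = 0 := fun j hj => by
      by_contra h
      exact absurd (Finset.le_max' _ j (DFinsupp.mem_support_iff.mpr h)) (not_le.mpr hj)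
    have ht := isIntegral_decompose_top 𝒮 hA hue hu hu0 hs hus htop
    by_cases hgm : m = g
    · exact hgm ▸ ht
    have hmem : (decompose 𝒮 s m : S) ∈ 𝒮 m := SetLike.coe_mem _
    have hsub : (decompose 𝒮 (s - decompose 𝒮 s m)).support ⊂ (decompose 𝒮 s).support := by
      refine (Finset.ssubset_iff_of_subset fun j hj => ?_).mpr ⟨m, hm, ?_⟩
      · by_cases hj' : m = j
        · exact hj' ▸ hm
        · rw [DFinsupp.mem_support_iff] at hj ⊢
          rwa [decompose_sub, DirectSum.sub_apply,
            show decompose 𝒮 (decompose 𝒮 s m : S) j = 0 from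
              Subtype.ext (decompose_of_mem_ne 𝒮 hmem hj'), sub_zero] at hj
      · rw [DFinsupp.mem_support_iff, not_not, decompose_sub, DirectSum.sub_apply, sub_eq_zero]
        exact (Subtype.ext (decompose_of_mem_same 𝒮 hmem)).symm
    have hus' : u * (s - decompose 𝒮 s m) ∈ A := by
      rw [mul_sub, ← coe_decompose_mul_of_mem_add 𝒮 hue]
      exact sub_mem hus (hA _ hus _)
    have h := IH _ (hc ▸ Finset.card_lt_card hsub) (hs.sub ht) hus' rfl
    rwa [decompose_sub, DirectSum.sub_apply, AddSubgroupClass.coe_sub, decompose_of_mem_ne 𝒮 hmem hgm,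
      sub_zero] at h
  · rw [Finset.not_nonempty_iff_eq_empty, DFinsupp.support_eq_empty] at hsupp
    rw [hsupp]
    exact isIntegral_zero

theorem isIntegral_decompose_of_mul_mem {R : Subring S}
    (hR : ∀ r ∈ R, ∀ g, (decompose 𝒮 r g : S) ∈ R) {u : S} {e : G} (hue : u ∈ 𝒮 e)
    (hu : u ∈ R) (hu0 : ∀ x : S, u * x = 0 → x = 0) {s : S} (hs : IsIntegral R s)
    (hus : u * s ∈ R) (g : G) : IsIntegral R (decompose 𝒮 s g : S) := by
  classical
  obtain ⟨p, hp, hps⟩ := hs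
  let comps (x : S) : Set S :=
    (fun i => (decompose 𝒮 x i : S)) '' ((decompose 𝒮 x).support : Set G)
  have mem_of_comps {x : S} {B : Subring S} (h : comps x ⊆ B) : x ∈ B := by
    rw [← sum_support_decompose 𝒮 x]
    exact sum_mem fun i hi => h ⟨i, hi, rfl⟩
  let q : Polynomial S := p.map R.subtype
  let T : Set S := {u} ∪ comps (u * s) ∪ ⋃ i ∈ Finset.range (p.natDegree + 1), comps (q.coeff i)
  have hTfin : T.Finite := by
    refine ((Set.finite_singleton u).union ((Finset.finite_toSet _).image _)).union ?_
    exact (Finset.finite_toSet _).biUnion fun i _ => (Finset.finite_toSet _).image _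
  have hThom : ∀ t ∈ T, SetLike.IsHomogeneousElem 𝒮 t := by
    rintro t ((rfl | ⟨i, -, rfl⟩) | ht)
    · exact ⟨e, hue⟩
    · exact ⟨i, SetLike.coe_mem _⟩
    · simp only [Set.mem_iUnion] at ht
      obtain ⟨_, _, i, -, rfl⟩ := ht
      exact ⟨i, SetLike.coe_mem _⟩
  have hTR : T ⊆ R := by
    rintro t ((rfl | ⟨i, -, rfl⟩) | ht)
    · exact hu
    · exact hR _ hus _
    · simp only [Set.mem_iUnion] at ht
      obtain ⟨j, _, i, -, rfl⟩ := ht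
      refine hR _ ?_ _
      simp [q]
  let A := Subring.closure T
  have : IsNoetherianRing A := is_noetherian_subring_closure T hTfin
  have hqA : ∀ i, q.coeff i ∈ A := fun i => by
    by_cases hi : i ∈ Finset.range (p.natDegree + 1)
    · refine mem_of_comps (Set.Subset.trans ?_ Subring.subset_closure)
      exact (Set.subset_biUnion_of_mem (u := fun i => comps (q.coeff i)) hi).trans
        Set.subset_union_right
    · rw [Finset.mem_range, not_lt] at hi
      simp [q, Polynomial.coeff_eq_zero_of_natDegree_lt (Nat.lt_of_succ_le hi)]
  have hsA : IsIntegral A s := by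
    have hq : q ∈ Polynomial.lifts A.subtype :=
      (Polynomial.lifts_iff_coeff_lifts q).mpr fun i => ⟨⟨_, hqA i⟩, rfl⟩
    obtain ⟨p', hp', -, hmonic⟩ :=
      Polynomial.lifts_and_natDegree_eq_and_monic hq (hp.map R.subtype)
    refine ⟨p', hmonic, ?_⟩
    change p'.eval₂ A.subtype s = 0
    rw [← Polynomial.eval_map, hp', Polynomial.eval_map]
    exact hps
  refine (isIntegral_decompose_of_isNoetherianRing 𝒮
    (fun r hr => decompose_mem_subringClosure 𝒮 hThom hr) hue
    (Subring.subset_closure (.inl (.inl rfl))) hu0 hsA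
    (mem_of_comps (Set.Subset.trans ?_ Subring.subset_closure)) g).of_subring_le
    (Subring.closure_le.mpr hTR)
  exact Set.subset_union_right.trans Set.subset_union_left

end Graded

theorem Localization.exists_mk_of_mem_closure {S : Type*} [CommRing S] {R : Subring S}
    {U : Submonoid S} (hUR : ∀ u ∈ U, u ∈ R) {x : Localization U}
    (hx : x ∈ Subring.closure {x : Localization U | ∃ r ∈ R, ∃ u : U, x = Localization.mk r u}) :
    ∃ r ∈ R, ∃ u : U, x = Localization.mk r u := by
  induction hx using Subring.closure_induction with
  | mem x hx => exact hx
  | zero => exact ⟨0, zero_mem _, 1, (Localization.mk_zero 1).symm⟩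
  | one => exact ⟨1, one_mem _, 1, Localization.mk_one.symm⟩
  | add x y _ _ hx hy =>
    obtain ⟨r, hr, u, rfl⟩ := hx
    obtain ⟨r', hr', u', rfl⟩ := hy
    exact ⟨_, add_mem (mul_mem (hUR u u.2) hr') (mul_mem (hUR u' u'.2) hr), _,
      Localization.add_mk r u r' u'⟩
  | neg x _ hx =>
    obtain ⟨r, hr, u, rfl⟩ := hx
    exact ⟨_, neg_mem hr, u, Localization.neg_mk r u⟩
  | mul x y _ _ hx hy =>
    obtain ⟨r, hr, u, rfl⟩ := hx
    obtain ⟨r', hr', u', rfl⟩ := hy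
    exact ⟨_, mul_mem hr hr', _, Localization.mk_mul r r' u u'⟩

/-- Let `G` be a totally ordered abelian monoid and `R ⊆ S` an extension of
reduced commutative `G`-graded rings.  Let `U` be the multiplicative set of homogeneous
elements of `R` that are non-zerodivisors on `S`, and assume that `U⁻¹R` is integrally closed
in `U⁻¹S`.  Then the integral closure of `R` in `S` is `G`-graded: every homogeneous component
of an element of `S` integral over `R` is again integral over `R`. -/
theorem integral_closure_graded_of_loc_integrally_closed
    {G : Type*} [AddCommMonoid G] [LinearOrder G]
    [CovariantClass G G (· + ·) (· < ·)]
    {S : Type*} [CommRing S] [IsReduced S]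
    (𝒮 : G → AddSubgroup S) [GradedRing 𝒮]
    (R : Subring S)
    -- the grading of `R` is induced from that of `S`
    (hRgraded : ∀ r ∈ R, ∀ g : G, (DirectSum.decompose 𝒮 r g : S) ∈ R)
    -- `U` is the set of homogeneous elements of `R` that are non-zerodivisors on `S`
    (U : Submonoid S)
    (hU : U = Submonoid.closure
      {u : S | u ∈ R ∧ (∃ g : G, u ∈ 𝒮 g) ∧ ∀ s : S, u * s = 0 → s = 0})
    -- `U⁻¹R`, viewed as a subring of `U⁻¹S`
    (Rloc : Subring (Localization U))
    (hRloc : Rloc = Subring.closure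
      {x : Localization U | ∃ r ∈ R, ∃ u : U, x = Localization.mk r u})
    -- `U⁻¹R` is integrally closed in `U⁻¹S`
    (hclosed : ∀ x : Localization U, IsIntegral Rloc x → x ∈ Rloc)
    (s : S) (hs : IsIntegral R s) (g : G) :
    IsIntegral R ((DirectSum.decompose 𝒮 s g : S)) := by

  have : IsOrderedCancelAddMonoid G := .of_add_lt_add_left fun a b c h =>
    CovariantClass.elim a h
  have hUprop : ∀ u ∈ U, u ∈ R ∧ (∃ g : G, u ∈ 𝒮 g) ∧ ∀ x : S, u * x = 0 → x = 0 := by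
    intro u hu
    rw [hU] at hu
    induction hu using Submonoid.closure_induction with
    | mem u hu => exact hu
    | one => exact ⟨one_mem _, ⟨0, SetLike.GradedOne.one_mem⟩, by simp⟩
    | mul a b _ _ ha hb =>
      obtain ⟨haR, ⟨i, hi⟩, ha0⟩ := ha
      obtain ⟨hbR, ⟨j, hj⟩, hb0⟩ := hb
      exact ⟨mul_mem haR hbR, ⟨i + j, SetLike.mul_mem_graded hi hj⟩,
        fun x hx => hb0 x (ha0 _ (by rw [← mul_assoc, hx]))⟩
  have hRRloc : ∀ r : R, algebraMap S (Localization U) r ∈ Rloc := fun r => by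
    rw [hRloc]
    exact Subring.subset_closure ⟨r, r.2, 1, (Localization.mk_one_eq_algebraMap _).symm⟩
  let φ : R →+* Rloc :=
    ((algebraMap S (Localization U)).comp R.subtype).codRestrict Rloc hRRloc
  have hsloc := hclosed _ (hs.map_of_comp_eq φ (algebraMap S (Localization U)) rfl)
  rw [hRloc] at hsloc
  obtain ⟨r, hr, u, h⟩ := Localization.exists_mk_of_mem_closure (fun u hu => (hUprop u hu).1) hsloc
  obtain ⟨huR, ⟨e, hue⟩, hu0⟩ := hUprop u u.2
  rw [← Localization.mk_one_eq_algebraMap, Localization.mk_eq_mk_iff,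
    Localization.r_iff_exists] at h
  obtain ⟨c, hc⟩ := h
  have hus : (u : S) * s = r := by
    have := (hUprop c c.2).2.2 (u * s - r) (by simpa [mul_sub, sub_eq_zero] using hc)
    exact sub_eq_zero.mp this
  exact isIntegral_decompose_of_mul_mem 𝒮 hRgraded hue huR hu0 hs (hus ▸ hr) g
end

section
/- Let G be a cancellative, torsion-free abelian monoid and let R ⊆ S be an extension of commutative G-graded rings. Then the integral closure of R in S is G-graded; that is, for every element s ∈ S that is integral over R, every homogeneous component of s is integral over R. -/
/-- A finite subset of a cancellative torsion-free abelian monoid can be separated by an additive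
map to `ℚ` which, after translation, takes natural values on that subset. -/
theorem exists_addMonoidHom_rat_injOn {G : Type*} [AddCancelCommMonoid G] [IsAddTorsionFree G]
    (F : Finset G) :
    ∃ (ψ : G →+ ℚ) (M : ℕ) (e : G → ℕ),
      (∀ h ∈ F, (e h : ℚ) = ψ h + M) ∧ Set.InjOn e F := by
  classical
  let K := Algebra.GrothendieckAddGroup G
  have hof : Function.Injective (Algebra.GrothendieckAddGroup.of (M := G)) :=
    Algebra.GrothendieckAddGroup.of_injective
  have hK : IsAddTorsionFree K := by
    refine ⟨fun n hn x y hxy ↦ ?_⟩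
    have key : ∀ z : K, n • z = 0 → z = 0 := by
      intro z hz
      induction z using AddLocalization.ind with
      | _ w =>
        obtain ⟨a, b, hb⟩ := w
        rw [AddLocalization.mk_nsmul, ← AddLocalization.mk_zero, AddLocalization.mk_eq_mk_iff,
          AddLocalization.r_iff_exists] at hz
        obtain ⟨c, hc⟩ := hz
        have hab : a = b := by
          refine nsmul_right_injective hn ?_
          simpa using hc
        subst hab
        exact AddLocalization.mk_self (⟨a, hb⟩ : (⊤ : AddSubmonoid G))
    exact sub_eq_zero.mp (key _ (by rw [nsmul_sub]; exact sub_eq_zero.mpr hxy))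
  let j : G →+ DivisibleHull K :=
    (DivisibleHull.coeAddMonoidHom K).comp Algebra.GrothendieckAddGroup.of
  have hj : Function.Injective j := fun a b hab ↦ hof (DivisibleHull.coe_injective hab)
  let P := {p : F × F // p.1 ≠ p.2}
  obtain ⟨f, hf⟩ := Module.exists_dual_forall_apply_ne_zero (K := ℚ)
    (fun p : P ↦ j p.1.1 - j p.1.2)
    (fun p h ↦ p.2 (Subtype.ext (hj (sub_eq_zero.mp h))))
  obtain ⟨N, hN⟩ := IsLocalization.exist_integer_multiples_of_finset (nonZeroDivisors ℤ)
    (F.image fun h ↦ f (j h))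
  have hN0 : (N : ℤ) ≠ 0 := nonZeroDivisors.coe_ne_zero N
  have hint : ∀ h : F, ∃ z : ℤ, (z : ℚ) = (N : ℤ) * f (j h) := fun h ↦ by
    obtain ⟨z, hz⟩ := hN (f (j h)) (Finset.mem_image_of_mem _ h.2)
    exact ⟨z, by simpa using hz⟩
  choose z hz using hint
  let M := ∑ h : F, (z h).natAbs
  have hM : ∀ h : F, 0 ≤ z h + M := fun h ↦ by
    have : (z h).natAbs ≤ M :=
      Finset.single_le_sum (f := fun h : F ↦ (z h).natAbs) (fun _ _ ↦ Nat.zero_le _)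
        (Finset.mem_univ h)
    omega
  let ψ : G →+ ℚ := (AddMonoidHom.mulLeft ((N : ℤ) : ℚ)).comp (f.toAddMonoidHom.comp j)
  let e : G → ℕ := fun h ↦ if hh : h ∈ F then (z ⟨h, hh⟩ + M).toNat else 0
  have he : ∀ h ∈ F, (e h : ℚ) = ψ h + M := fun h hh ↦ by
    have h1 : ((e h : ℤ) : ℚ) = ((z ⟨h, hh⟩ + M : ℤ) : ℚ) := by
      simp only [e, dif_pos hh, Int.toNat_of_nonneg (hM ⟨h, hh⟩)]
    rw [Int.cast_add, hz] at h1
    exact_mod_cast h1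
  refine ⟨ψ, M, e, he, fun a ha b hb hab ↦ ?_⟩
  by_contra hne
  refine hf ⟨(⟨a, ha⟩, ⟨b, hb⟩), fun h ↦ hne (congrArg Subtype.val h)⟩ ?_
  have h1 : ψ a = ψ b := by
    have := he a ha
    rw [hab, he b hb] at this
    linarith
  have h2 : ((N : ℤ) : ℚ) * f (j a) = ((N : ℤ) : ℚ) * f (j b) := h1
  rw [map_sub, sub_eq_zero]
  exact mul_left_cancel₀ (Int.cast_ne_zero.mpr hN0) h2

namespace GradedRing

variable {G A S : Type*} [AddCommMonoid G] [DecidableEq G] [AddCommMonoid A] [CommRing S]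
  (𝒮 : G → AddSubgroup S) [GradedRing 𝒮]

/-- The ring homomorphism `s ↦ ∑ g, s_g T ^ ψ g` from a `G`-graded ring to its monoid algebra
on `A`, induced by an additive map `ψ : G →+ A`. -/
noncomputable def toAddMonoidAlgebra (ψ : G →+ A) : S →+* AddMonoidAlgebra S A :=
  (DirectSum.toSemiring
    (fun g ↦ (AddMonoidAlgebra.singleAddHom (ψ g)).comp (𝒮 g).subtype)
    (by simp [AddMonoidAlgebra.one_def])
    (fun a b ↦ by simp [AddMonoidAlgebra.single_mul_single])).comp
  (DirectSum.decomposeRingEquiv 𝒮).toRingHom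

theorem toAddMonoidAlgebra_coe (ψ : G →+ A) {g : G} (x : 𝒮 g) :
    toAddMonoidAlgebra 𝒮 ψ (x : S) = AddMonoidAlgebra.single (ψ g) (x : S) := by
  have hx : (DirectSum.decomposeRingEquiv 𝒮).toRingHom (x : S) =
      DirectSum.of (fun g ↦ 𝒮 g) g x := DirectSum.decompose_coe 𝒮 x
  rw [toAddMonoidAlgebra, RingHom.comp_apply, hx, DirectSum.toSemiring_of]
  rfl

theorem toAddMonoidAlgebra_apply (ψ : G →+ A) (F : Finset G) (s : S)
    (hF : ∀ g ∉ F, (DirectSum.decompose 𝒮 s g : S) = 0) :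
    toAddMonoidAlgebra 𝒮 ψ s =
      ∑ g ∈ F, AddMonoidAlgebra.single (ψ g) (DirectSum.decompose 𝒮 s g : S) := by
  classical
  have hs : s = ∑ g ∈ F, (DirectSum.decompose 𝒮 s g : S) := by
    conv_lhs => rw [← DirectSum.sum_support_decompose 𝒮 s]
    refine Finset.sum_subset (fun g hg ↦ ?_) (fun g _ hg ↦ by simpa using hg)
    by_contra h
    exact DFinsupp.mem_support_iff.mp hg (Subtype.ext (hF g h))
  conv_lhs => rw [hs]
  simp only [map_sum, toAddMonoidAlgebra_coe]

end GradedRing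

namespace Polynomial

/-- The embedding of polynomials into the monoid algebra on `ℚ`. -/
noncomputable def toAddMonoidAlgebraRat (S : Type*) [CommRing S] :
    S[X] →+* AddMonoidAlgebra S ℚ :=
  (AddMonoidAlgebra.mapDomainRingHom S (Nat.castAddMonoidHom ℚ)).comp (toFinsuppIso S).toRingHom

theorem toAddMonoidAlgebraRat_injective (S : Type*) [CommRing S] :
    Function.Injective (toAddMonoidAlgebraRat S) :=
  (AddMonoidAlgebra.mapDomain_injective Nat.cast_injective).comp (toFinsuppIso S).injective

theorem toAddMonoidAlgebraRat_monomial {S : Type*} [CommRing S] (n : ℕ) (a : S) :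
    toAddMonoidAlgebraRat S (monomial n a) = AddMonoidAlgebra.single (n : ℚ) a := by
  simp [toAddMonoidAlgebraRat]

end Polynomial


/-- Let `G` be a cancellative, torsion-free abelian monoid and `R ⊆ S` an
extension of commutative `G`-graded rings.  Then the integral closure of `R` in `S` is
`G`-graded: every homogeneous component of an element of `S` integral over `R` is again
integral over `R`. -/
theorem integral_closure_graded_cancel_torsionfree
    {G : Type*} [AddCancelCommMonoid G] [DecidableEq G]
    -- `G` is torsion-free
    (htf : ∀ (f g : G) (k : ℕ), 0 < k → k • f = k • g → f = g)
    {S : Type*} [CommRing S]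
    (𝒮 : G → AddSubgroup S) [GradedRing 𝒮]
    (R : Subring S)
    -- the grading of `R` is induced from that of `S`
    (hRgraded : ∀ r ∈ R, ∀ g : G, (DirectSum.decompose 𝒮 r g : S) ∈ R)
    (s : S) (hs : IsIntegral R s) (g : G) :
    IsIntegral R ((DirectSum.decompose 𝒮 s g : S)) := by
  classical
  have : IsAddTorsionFree G := ⟨fun n hn x y h ↦ htf x y n (Nat.pos_of_ne_zero hn) h⟩
  obtain ⟨p, hp, hps⟩ := hs
  let n := p.natDegree
  let F : Finset G := (DirectSum.decompose 𝒮 s).support ∪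
    (Finset.range n).biUnion fun i ↦ (DirectSum.decompose 𝒮 (p.coeff i : S)).support
  have hFs : ∀ h ∉ F, (DirectSum.decompose 𝒮 s h : S) = 0 := fun h hh ↦ by
    simp only [F, Finset.mem_union, not_or] at hh
    simpa using hh.1
  have hFp : ∀ i < n, ∀ h ∉ F, (DirectSum.decompose 𝒮 (p.coeff i : S) h : S) = 0 :=
    fun i hi h hh ↦ by
      simp only [F, Finset.mem_union, not_or, Finset.mem_biUnion, not_exists, not_and] at hh
      simpa using hh.2 i (Finset.mem_range.mpr hi)
  obtain ⟨ψ, M, e, he, hinj⟩ := exists_addMonoidHom_rat_injOn F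
  let C := GradedRing.toAddMonoidAlgebra 𝒮 ψ
  let ι := Polynomial.toAddMonoidAlgebraRat S
  let σ : AddMonoidAlgebra S ℚ := AddMonoidAlgebra.single (M : ℚ) 1
  have hσ (k : ℕ) : σ ^ k = AddMonoidAlgebra.single ((M * k : ℕ) : ℚ) 1 := by
    simp [σ, AddMonoidAlgebra.single_pow, mul_comm]
  let q : Polynomial S :=
    ∑ h ∈ F, Polynomial.monomial (e h) (DirectSum.decompose 𝒮 s h : S)
  have hq : ι q = C s * σ := by
    simp only [q, C, ι, map_sum, Polynomial.toAddMonoidAlgebraRat_monomial,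
      GradedRing.toAddMonoidAlgebra_apply 𝒮 ψ F s hFs, Finset.sum_mul]
    refine Finset.sum_congr rfl fun h hh ↦ ?_
    rw [AddMonoidAlgebra.single_mul_single, mul_one, he h hh]
  let b : ℕ → Polynomial R := fun i ↦ ∑ h ∈ F, Polynomial.monomial (e h + M * (n - i - 1))
    (⟨DirectSum.decompose 𝒮 (p.coeff i : S) h, hRgraded _ (p.coeff i).2 h⟩ : R)
  have hb : ∀ i < n, ι ((b i).map (algebraMap R S)) = C (p.coeff i : S) * σ ^ (n - i) := by
    intro i hi
    simp only [b, C, ι, Polynomial.map_sum, Polynomial.map_monomial, map_sum,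
      Polynomial.toAddMonoidAlgebraRat_monomial,
      GradedRing.toAddMonoidAlgebra_apply 𝒮 ψ F _ (hFp i hi), Finset.sum_mul]
    refine Finset.sum_congr rfl fun h hh ↦ ?_
    obtain ⟨k, hk⟩ : ∃ k, n - i = k + 1 := ⟨n - i - 1, by omega⟩
    rw [hσ, AddMonoidAlgebra.single_mul_single, mul_one, hk]
    push_cast
    rw [he h hh]
    refine congrArg (AddMonoidAlgebra.single · _) ?_
    ring
  let : Algebra (Polynomial R) (Polynomial S) := Polynomial.algebra R S
  have hint : IsIntegral (Polynomial R) q := by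
    refine ⟨Polynomial.X ^ n + ∑ i ∈ Finset.range n, Polynomial.C (b i) * Polynomial.X ^ i,
      Polynomial.monic_X_pow_add ?_, ?_⟩
    · exact Polynomial.mem_degreeLT.mp <| Submodule.sum_mem _ fun i hi ↦
        Polynomial.mem_degreeLT.mpr <| (Polynomial.degree_C_mul_X_pow_le i _).trans_lt <| by
          exact_mod_cast Finset.mem_range.mp hi
    · apply Polynomial.toAddMonoidAlgebraRat_injective S
      have hps' : C s ^ n + ∑ i ∈ Finset.range n, C (p.coeff i : S) * C s ^ i = 0 := by
        rw [hp.as_sum] at hps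
        simp only [Polynomial.eval₂_add, Polynomial.eval₂_pow, Polynomial.eval₂_X,
          Polynomial.eval₂_finsetSum, Polynomial.eval₂_mul, Polynomial.eval₂_C] at hps
        have hC := congrArg C hps
        simp only [map_add, map_pow, map_sum, map_mul, map_zero] at hC
        exact hC
      have hterm : ∀ i ∈ Finset.range n, ι ((b i).map (algebraMap R S)) * ι q ^ i =
          σ ^ n * (C (p.coeff i : S) * C s ^ i) := by
        intro i hi
        have hi' := Finset.mem_range.mp hi
        rw [hb i hi', hq, ← Nat.sub_add_cancel hi'.le, Nat.add_sub_cancel, pow_add]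
        ring
      rw [map_zero]
      simp only [Polynomial.eval₂_add, Polynomial.eval₂_pow, Polynomial.eval₂_X,
        Polynomial.eval₂_finsetSum, Polynomial.eval₂_mul, Polynomial.eval₂_C, map_add,
        map_sum, map_mul, map_pow, Polynomial.algebraMap_def, Polynomial.coe_mapRingHom]
      change ι q ^ n + ∑ i ∈ Finset.range n, ι ((b i).map (algebraMap R S)) * ι q ^ i = 0
      rw [Finset.sum_congr rfl hterm, hq, mul_pow, ← Finset.mul_sum, mul_comm (C s ^ n), ← mul_add,
        hps', mul_zero]
  by_cases hg : g ∈ F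
  · have hcoeff : q.coeff (e g) = DirectSum.decompose 𝒮 s g := by
      simp only [q, Polynomial.finsetSum_coeff, Polynomial.coeff_monomial]
      rw [Finset.sum_eq_single_of_mem g hg fun h hh hne ↦ if_neg fun h' ↦ hne (hinj hh hg h')]
      simp
    exact hcoeff ▸ hint.coeff (e g)
  · rw [hFs g hg]
    exact isIntegral_zero
end

section
/- Let R be a commutative ring, t an indeterminate, and I an ideal of R. The integral closure of the Rees algebra R[It] inside the polynomial ring R[t] is the graded subring ⊕_{m ≥ 0} \overline{I^m} t^m; that is, a polynomial f ∈ R[t] is integral over R[It] if and only if for every m ≥ 0 the coefficient of t^m in f lies in the integral closure \overline{I^m} of I^m. -/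
/-- `x` is integral over the ideal `I`: there are `m ≥ 1` and `a j ∈ I ^ j` (`j = 1, …, m`)
with `x ^ m + a 1 * x ^ (m - 1) + ⋯ + a m = 0`. -/
def IdealIntegral {R : Type*} [CommRing R] (I : Ideal R) (x : R) : Prop :=
  ∃ m : ℕ, 0 < m ∧ ∃ a : ℕ → R, (∀ j ∈ Finset.Icc 1 m, a j ∈ I ^ j) ∧
    x ^ m + ∑ j ∈ Finset.Icc 1 m, a j * x ^ (m - j) = 0

open Polynomial in
attribute [local instance] Polynomial.algebra in
/-- If `f` is integral over the Rees algebra of `I`, then so is each of its homogeneous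
components. -/
theorem isIntegral_reesAlgebra_monomial_coeff {R : Type*} [CommRing R] {I : Ideal R} {f : R[X]}
    (hf : IsIntegral (reesAlgebra I) f) (m : ℕ) :
    IsIntegral (reesAlgebra I) (monomial m (f.coeff m)) := by
  let φ : R[X] →+* R[X][X] := eval₂RingHom (C.comp C) (C X * X)
  have hφ (g : R[X]) (k : ℕ) : (φ g).coeff k = monomial k (g.coeff k) := by
    induction g using Polynomial.induction_on' with
    | add p q hp hq => simp [hp, hq]
    | monomial n a =>
      simp only [φ, coe_eval₂RingHom, eval₂_monomial, RingHom.comp_apply, mul_pow, ← C_pow,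
        ← mul_assoc, ← C_mul, coeff_C_mul, coeff_X_pow, coeff_monomial]
      split_ifs with h₁ h₂ h₂
      · simp [h₁, C_mul_X_pow_eq_monomial]
      · exact absurd h₁.symm h₂
      · exact absurd h₂.symm h₁
      · simp
  let ι : (reesAlgebra I)[X] →+* R[X][X] := mapRingHom (algebraMap (reesAlgebra I) R[X])
  have hι : Function.Injective ι := map_injective _ Subtype.val_injective
  have hmem (g : reesAlgebra I) : φ g ∈ ι.rangeS := by
    rw [mem_map_rangeS]
    intro k
    exact ⟨⟨monomial k ((g : R[X]).coeff k), reesAlgebra.monomial_mem.mpr (g.2 k)⟩,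
      (hφ g k).symm⟩
  let e : (reesAlgebra I)[X] ≃+* ι.rangeS :=
    RingEquiv.ofBijective ι.rangeSRestrict
      ⟨fun _ _ h ↦ hι (congrArg Subtype.val h), ι.rangeSRestrict_surjective⟩
  let ψ : reesAlgebra I →+* (reesAlgebra I)[X] :=
    (e.symm : ι.rangeS →+* (reesAlgebra I)[X]).comp
      ((φ.comp (algebraMap (reesAlgebra I) R[X])).codRestrict ι.rangeS hmem)
  have hψ : (algebraMap (reesAlgebra I)[X] R[X][X]).comp ψ =
      φ.comp (algebraMap (reesAlgebra I) R[X]) :=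
    RingHom.ext fun g ↦ congrArg Subtype.val (e.apply_symm_apply ⟨φ g, hmem g⟩)
  rw [← hφ]
  exact (hf.map_of_comp_eq ψ φ hψ).coeff m

open Polynomial in
theorem IdealIntegral.isIntegral_monomial {R : Type*} [CommRing R] {I : Ideal R} {m : ℕ} {x : R}
    (hx : IdealIntegral (I ^ m) x) : IsIntegral (reesAlgebra I) (monomial m x : R[X]) := by
  obtain ⟨n, hn, a, ha, h⟩ := hx
  have hmem (j : Finset.Icc 1 n) : monomial (m * j) (a j) ∈ reesAlgebra I :=
    reesAlgebra.monomial_mem.mpr (pow_mul I m j ▸ ha j j.2)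
  refine ⟨X ^ n + ∑ j : Finset.Icc 1 n, C ⟨_, hmem j⟩ * X ^ (n - j : ℕ), ?_, ?_⟩
  · refine monic_X_pow_add ((degree_sum_le _ _).trans_lt ?_)
    refine (Finset.sup_lt_iff (WithBot.bot_lt_coe n)).mpr ?_
    intro j _
    have hj := Finset.mem_Icc.mp j.2
    exact (degree_C_mul_X_pow_le _ _).trans_lt (WithBot.coe_lt_coe.mpr (by grind))
  · have key (j : Finset.Icc 1 n) : (monomial (m * j) (a j) : R[X]) * monomial m x ^ (n - j : ℕ) =
        monomial (m * n) (a j * x ^ (n - j : ℕ)) := by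
      have hj := Finset.mem_Icc.mp j.2
      rw [monomial_pow, monomial_mul_monomial, ← mul_add, Nat.add_sub_cancel' hj.2]
    simp only [eval₂_add, eval₂_X_pow, eval₂_finsetSum, eval₂_mul, eval₂_C]
    change _ + ∑ j : Finset.Icc 1 n,
      (monomial (m * j) (a j) : R[X]) * monomial m x ^ (n - j : ℕ) = 0
    simp only [key]
    rw [Finset.sum_coe_sort (Finset.Icc 1 n)
      fun j ↦ (monomial (m * n) (a j * x ^ (n - j)) : R[X]), monomial_pow, ← map_sum, ← map_add, h,
      map_zero]

open Polynomial in
theorem IdealIntegral.of_isIntegral_monomial {R : Type*} [CommRing R] {I : Ideal R} {m : ℕ} {x : R}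
    (hx : IsIntegral (reesAlgebra I) (monomial m x : R[X])) : IdealIntegral (I ^ m) x := by
  cases subsingleton_or_nontrivial R
  · exact ⟨1, one_pos, 0, fun j _ ↦ zero_mem _, Subsingleton.elim _ _⟩
  obtain ⟨p, hp, h⟩ := hx
  have hn : 0 < p.natDegree := by
    by_contra! h0
    rw [hp.natDegree_eq_zero.mp (by lia), eval₂_one] at h
    exact one_ne_zero h
  refine ⟨p.natDegree, hn, fun j ↦ (p.coeff (p.natDegree - j) : R[X]).coeff (m * j),
    fun j _ ↦ pow_mul I m j ▸ (p.coeff (p.natDegree - j)).2 _, ?_⟩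
  have h' := congrArg (coeff · (m * p.natDegree)) h
  simp only [eval₂_eq_sum_range, finsetSum_coeff, coeff_zero] at h'
  rw [← Finset.sum_flip, Finset.sum_range_eq_add_Ico _ (Nat.succ_pos _)] at h'
  have key (j : ℕ) (hj : j ≤ p.natDegree) :
      (algebraMap (reesAlgebra I) R[X] (p.coeff (p.natDegree - j)) *
        monomial m x ^ (p.natDegree - j)).coeff (m * p.natDegree) =
      (p.coeff (p.natDegree - j) : R[X]).coeff (m * j) * x ^ (p.natDegree - j) := by
    rw [monomial_pow, show m * p.natDegree = m * j + m * (p.natDegree - j) by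
      rw [← mul_add, Nat.add_sub_cancel' hj], coeff_mul_monomial]
    rfl
  rw [key 0 (Nat.zero_le _)] at h'
  rw [← h']
  congr 1
  · simp [hp.coeff_natDegree]
  · exact Finset.sum_congr rfl fun j hj ↦ (key j (by grind)).symm

/-- For an ideal `I` of a commutative ring `R`, the integral closure of the
Rees algebra `R[It]` inside `R[t]` is `⊕_{m ≥ 0} \overline{I^m} t^m`: a polynomial
`f ∈ R[t]` is integral over `R[It]` iff each coefficient of `t^m` in `f` is integral
over `I ^ m`. -/
theorem integral_closure_reesAlgebra
    {R : Type*} [CommRing R] (I : Ideal R) (f : Polynomial R) :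
    IsIntegral (reesAlgebra I) f ↔ ∀ m : ℕ, IdealIntegral (I ^ m) (f.coeff m) := by
  refine ⟨fun hf m ↦ .of_isIntegral_monomial (isIntegral_reesAlgebra_monomial_coeff hf m),
    fun h ↦ ?_⟩
  rw [f.as_sum_support]
  exact IsIntegral.sum _ fun m _ ↦ (h m).isIntegral_monomial
end

section
/- Let I be a monomial ideal in the polynomial ring R = K[x_1,…,x_n] over a field K. Then the integral closure \bar{I} of I is again a monomial ideal; indeed \bar{I} is the ideal generated by all monomials x^α (α ∈ ℕ^n) such that x^{mα} ∈ I^m for some positive integer m, and a monomial x^α lies in \bar{I} if and only if x^{mα} ∈ I^m for some positive integer m. -/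
open MvPolynomial in
theorem MvPolynomial.exists_span_monomial_image_eq_pow {σ R : Type*} [CommSemiring R]
    (A : Set (σ →₀ ℕ)) (k : ℕ) :
    ∃ B : Set (σ →₀ ℕ), Ideal.span ((fun α => monomial α (1 : R)) '' A) ^ k =
      Ideal.span ((fun α => monomial α (1 : R)) '' B) := by
  induction k with
  | zero =>
    refine ⟨{0}, ?_⟩
    rw [pow_zero, Set.image_singleton, ← C_apply, C_1, Ideal.span_singleton_one, Ideal.one_eq_top]
  | succ k ih =>
    obtain ⟨B, hB⟩ := ih
    refine ⟨Set.image2 (· + ·) B A, ?_⟩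
    rw [pow_succ, hB, Ideal.span_mul_span', Set.image_image2, ← Set.image2_mul,
      Set.image2_image_left, Set.image2_image_right]
    simp [monomial_mul]

open MvPolynomial in
theorem MvPolynomial.monomial_mem_span_pow_of_mem_support {σ R : Type*} [CommSemiring R]
    (A : Set (σ →₀ ℕ)) (k : ℕ) {f : MvPolynomial σ R}
    (hf : f ∈ Ideal.span ((fun α => monomial α (1 : R)) '' A) ^ k)
    {α : σ →₀ ℕ} (hα : α ∈ f.support) :
    monomial α (1 : R) ∈ Ideal.span ((fun α => monomial α (1 : R)) '' A) ^ k := by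
  obtain ⟨B, hB⟩ := exists_span_monomial_image_eq_pow (R := R) A k
  rw [hB, mem_ideal_span_monomial_image] at hf ⊢
  intro β hβ
  rw [Finset.mem_singleton.mp (support_monomial_subset hβ)]
  exact hf α hα

open Polynomial in
theorem idealIntegral_iff_isIntegral_monomial {R : Type*} [CommRing R] [Nontrivial R]
    (I : Ideal R) (x : R) :
    IdealIntegral I x ↔ IsIntegral (reesAlgebra I) (monomial 1 x : R[X]) := by
  constructor
  · rintro ⟨m, hm, a, ha, h⟩
    let b : ℕ → reesAlgebra I := fun j =>
      if hj : j ∈ Finset.Icc 1 m then ⟨monomial j (a j), reesAlgebra.monomial_mem.mpr (ha j hj)⟩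
      else 0
    refine ⟨X ^ m + ∑ j ∈ Finset.Icc 1 m, C (b j) * X ^ (m - j), monic_X_pow_add ?_, ?_⟩
    · refine (degree_sum_le _ _).trans_lt ((Finset.sup_lt_iff (WithBot.bot_lt_coe m)).mpr ?_)
      intro j hj
      refine (degree_C_mul_X_pow_le _ _).trans_lt ?_
      have := Finset.mem_Icc.mp hj
      exact WithBot.coe_lt_coe.mpr (by simp only [Nat.cast_id]; omega)
    · rw [eval₂_add, eval₂_X_pow, eval₂_finsetSum, monomial_pow, one_mul]
      have key : ∀ j ∈ Finset.Icc 1 m,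
          eval₂ (algebraMap (reesAlgebra I) R[X]) (monomial 1 x) (C (b j) * X ^ (m - j)) =
            monomial m (a j * x ^ (m - j)) := by
        intro j hj
        have hb : algebraMap (reesAlgebra I) R[X] (b j) = monomial j (a j) := by
          simp only [b, dif_pos hj]
          rfl
        have := Finset.mem_Icc.mp hj
        rw [eval₂_mul, eval₂_C, eval₂_X_pow, hb, monomial_pow, monomial_mul_monomial, one_mul,
          Nat.add_sub_cancel' this.2]
      rw [Finset.sum_congr rfl key, ← map_sum, ← map_add, h, map_zero]
  · rintro ⟨p, hp, h⟩
    have hm : 0 < p.natDegree := by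
      rw [hp.natDegree_pos]
      rintro rfl
      simp at h
    refine ⟨p.natDegree, hm, fun j => (p.coeff (p.natDegree - j) : R[X]).coeff j,
      fun j _ => (p.coeff (p.natDegree - j)).2 j, ?_⟩
    have h' := congrArg (fun q : R[X] => q.coeff p.natDegree) h
    have hterm : ∀ i ≤ p.natDegree,
        (algebraMap (reesAlgebra I) R[X] (p.coeff i) * monomial 1 x ^ i).coeff p.natDegree =
          (p.coeff i : R[X]).coeff (p.natDegree - i) * x ^ i := by
      intro i hi
      rw [monomial_pow, one_mul]
      conv_lhs => rw [← Nat.sub_add_cancel hi]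
      exact coeff_mul_monomial _ _ _ _
    simp only [eval₂_eq_sum_range, finsetSum_coeff, coeff_zero] at h'
    rw [Finset.sum_range_succ, hterm _ le_rfl, hp.coeff_natDegree] at h'
    rw [← h', add_comm]
    congr 1
    · refine Finset.sum_nbij' (p.natDegree - ·) (p.natDegree - ·) ?_ ?_ ?_ ?_ ?_
      · intro j hj
        simp only [Finset.mem_Icc, Finset.mem_range] at *
        omega
      · intro j hj
        simp only [Finset.mem_Icc, Finset.mem_range] at *
        omega
      · intro j hj
        simp only [Finset.mem_Icc] at *
        omega
      · intro j hj
        simp only [Finset.mem_range] at *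
        omega
      · intro j hj
        rw [hterm _ (Nat.sub_le _ _), Nat.sub_sub_self (Finset.mem_Icc.mp hj).2]
    · simp

theorem IdealIntegral.exists_forall_pow_mem {R : Type*} [CommRing R] {I : Ideal R} {x : R}
    (hx : IdealIntegral I x) : ∃ c : ℕ, ∀ k, x ^ (c + k) ∈ I ^ k := by
  obtain ⟨m, -, a, ha, h⟩ := hx
  suffices H : ∀ N, x ^ N ∈ I ^ (N - m) from ⟨m, fun k => by simpa using H (m + k)⟩
  intro N
  induction N using Nat.strong_induction_on with
  | _ N ih =>
    rcases lt_or_ge N m with hN | hN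
    · simp [Nat.sub_eq_zero_of_le hN.le]
    have hxN : x ^ N = -∑ j ∈ Finset.Icc 1 m, a j * x ^ (N - j) := by
      rw [← Nat.sub_add_cancel hN, pow_add, eq_neg_of_add_eq_zero_left h, mul_neg, Finset.mul_sum]
      congr 1
      refine Finset.sum_congr rfl fun j hj => ?_
      rw [Nat.add_sub_assoc (Finset.mem_Icc.mp hj).2, pow_add]
      ring
    rw [hxN]
    refine neg_mem (sum_mem fun j hj => ?_)
    have hj' := Finset.mem_Icc.mp hj
    refine Ideal.pow_le_pow_right (by omega : N - m ≤ j + (N - j - m)) ?_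
    rw [pow_add]
    exact Ideal.mul_mem_mul (ha j hj) (ih _ (by omega))

theorem idealIntegral_of_forall_mul_pow_mem {R : Type*} [CommRing R] [IsDomain R]
    [IsNoetherianRing R] {I : Ideal R} {x r : R} (hr : r ≠ 0) (h : ∀ k, r * x ^ k ∈ I ^ k) :
    IdealIntegral I x := by
  rw [idealIntegral_iff_isIntegral_monomial]
  refine IsAlmostIntegral.isIntegral ⟨algebraMap R (reesAlgebra I) r, ?_, fun k => ?_⟩
  · rw [mem_nonZeroDivisors_iff_ne_zero]
    intro h0
    exact hr (by simpa using congrArg Subtype.val h0)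
  · refine ⟨⟨Polynomial.monomial k (r * x ^ k), reesAlgebra.monomial_mem.mpr (h k)⟩, ?_⟩
    rw [algebraMap_smul, Polynomial.monomial_pow, Polynomial.smul_monomial, one_mul, smul_eq_mul]
    rfl

theorem IdealIntegral.of_pow_mem {R : Type*} [CommRing R] {I : Ideal R} {x : R} {m : ℕ}
    (hm : 0 < m) (hx : x ^ m ∈ I ^ m) : IdealIntegral I x := by
  refine ⟨m, hm, fun j => if j = m then -x ^ m else 0, fun j _ => ?_, ?_⟩
  · by_cases hj : j = m
    · simpa [hj] using hx
    · simp [hj]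
  · rw [Finset.sum_eq_single_of_mem m (Finset.mem_Icc.mpr ⟨hm, le_rfl⟩)]
    · simp
    · intro j _ hj
      simp [hj]

/-- The integral closure of an ideal. -/
def Ideal.intClosure {R : Type*} [CommRing R] [Nontrivial R] (I : Ideal R) : Ideal R where
  carrier := {x | IdealIntegral I x}
  zero_mem' := .of_pow_mem one_pos (by simp)
  add_mem' {x y} hx hy := by
    change IdealIntegral I (x + y)
    rw [idealIntegral_iff_isIntegral_monomial, map_add]
    exact ((idealIntegral_iff_isIntegral_monomial I x).mp hx).add
      ((idealIntegral_iff_isIntegral_monomial I y).mp hy)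
  smul_mem' r x hx := by
    change IdealIntegral I (r • x)
    rw [idealIntegral_iff_isIntegral_monomial]
    have := ((idealIntegral_iff_isIntegral_monomial I x).mp hx).smul
      (algebraMap R (reesAlgebra I) r)
    rwa [algebraMap_smul, Polynomial.smul_monomial] at this

theorem Ideal.mem_intClosure {R : Type*} [CommRing R] [Nontrivial R] {I : Ideal R} {x : R} :
    x ∈ I.intClosure ↔ IdealIntegral I x := Iff.rfl

open MvPolynomial in
theorem IdealIntegral.exists_monomial_nsmul_mem {σ R : Type*} [CommRing R] [Nontrivial R]
    {A : Set (σ →₀ ℕ)} {α : σ →₀ ℕ}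
    (h : IdealIntegral (Ideal.span ((fun α => monomial α (1 : R)) '' A)) (monomial α 1)) :
    ∃ m : ℕ, 0 < m ∧
      monomial (m • α) (1 : R) ∈ Ideal.span ((fun α => monomial α (1 : R)) '' A) ^ m := by
  classical
  obtain ⟨m, -, a, ha, h⟩ := h
  have h' := congrArg (coeff (m • α)) h
  rw [coeff_add, monomial_pow, one_pow, coeff_monomial, if_pos rfl, coeff_sum, coeff_zero] at h'
  obtain ⟨j, hj, hne⟩ : ∃ j ∈ Finset.Icc 1 m,
      coeff (m • α) (a j * monomial α (1 : R) ^ (m - j)) ≠ 0 := by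
    by_contra! H
    rw [Finset.sum_eq_zero H] at h'
    simp at h'
  have hj' := Finset.mem_Icc.mp hj
  refine ⟨j, hj'.1, monomial_mem_span_pow_of_mem_support A j (ha j hj) ?_⟩
  rw [monomial_pow, one_pow, ← Nat.add_sub_cancel' hj'.2, add_smul, Nat.add_sub_cancel_left,
    coeff_mul_monomial, mul_one] at hne
  exact mem_support_iff.mpr hne

open MvPolynomial in
/-- The leading monomial of an integral element is integral, by almost integrality. -/
theorem IdealIntegral.monomial_degree {σ K : Type*} [Finite σ] [Field K] (ord : MonomialOrder σ)
    {A : Set (σ →₀ ℕ)} {f : MvPolynomial σ K} (hf0 : f ≠ 0)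
    (hf : IdealIntegral (Ideal.span ((fun α => monomial α (1 : K)) '' A)) f) :
    IdealIntegral (Ideal.span ((fun α => monomial α (1 : K)) '' A))
      (monomial (ord.degree f) 1) := by
  obtain ⟨c, hc⟩ := hf.exists_forall_pow_mem
  refine idealIntegral_of_forall_mul_pow_mem (r := monomial (c • ord.degree f) 1) (by simp)
    fun k => ?_
  rw [monomial_pow, one_pow, monomial_mul, one_mul, ← add_smul, ← ord.degree_pow]
  exact monomial_mem_span_pow_of_mem_support A k (hc k)
    (ord.degree_mem_support (pow_ne_zero _ hf0))

open MvPolynomial in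
theorem IdealIntegral.monomial_of_mem_support {σ K : Type*} [Finite σ] [Field K]
    (ord : MonomialOrder σ) {A : Set (σ →₀ ℕ)} {f : MvPolynomial σ K}
    (hf : IdealIntegral (Ideal.span ((fun α => monomial α (1 : K)) '' A)) f)
    {α : σ →₀ ℕ} (hα : α ∈ f.support) :
    IdealIntegral (Ideal.span ((fun α => monomial α (1 : K)) '' A)) (monomial α 1) := by
  classical
  induction hN : f.support.card generalizing f with
  | zero => simp_all
  | succ N ih =>
    have hf0 : f ≠ 0 := by
      rintro rfl
      simp at hα
    have hd := hf.monomial_degree ord hf0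
    by_cases hαd : α = ord.degree f
    · rwa [hαd]
    have hsupp : (f - ord.leadingTerm f).support = f.support.erase (ord.degree f) := by
      ext β
      by_cases hβ : ord.degree f = β
      · simp [MonomialOrder.leadingTerm, ← hβ, MonomialOrder.leadingCoeff]
      · simp [MonomialOrder.leadingTerm, coeff_monomial, hβ, Ne.symm hβ]
    refine ih (f := f - ord.leadingTerm f) ?_ ?_ ?_
    · rw [← Ideal.mem_intClosure] at hf hd ⊢
      refine sub_mem hf ?_
      have := Ideal.mul_mem_left _ (C (ord.leadingCoeff f)) hd
      rwa [C_mul_monomial, mul_one] at this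
    · rw [hsupp]
      exact Finset.mem_erase.mpr ⟨hαd, hα⟩
    · rw [hsupp, Finset.card_erase_of_mem (ord.degree_mem_support hf0), hN,
        Nat.add_sub_cancel]

/-- Let `I` be a monomial ideal in `K[x_1, …, x_n]`.  Then the integral
closure `Ī` of `I` is the (monomial) ideal generated by the monomials `x^α` with
`x^(mα) ∈ I^m` for some `m ≥ 1`; moreover a monomial `x^α` lies in `Ī` iff
`x^(mα) ∈ I^m` for some `m ≥ 1`. -/
theorem integral_closure_of_monomial_ideal
    {K : Type*} [Field K] {n : ℕ}
    (I : Ideal (MvPolynomial (Fin n) K))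
    -- `I` is a monomial ideal
    (hI : ∃ A : Set (Fin n →₀ ℕ),
      I = Ideal.span ((fun α => MvPolynomial.monomial α (1 : K)) '' A)) :
    (∀ x : MvPolynomial (Fin n) K, IdealIntegral I x ↔
        x ∈ Ideal.span {p : MvPolynomial (Fin n) K | ∃ α : Fin n →₀ ℕ,
          (∃ m : ℕ, 0 < m ∧ MvPolynomial.monomial (m • α) (1 : K) ∈ I ^ m) ∧
          p = MvPolynomial.monomial α (1 : K)}) ∧
    (∀ α : Fin n →₀ ℕ, IdealIntegral I (MvPolynomial.monomial α (1 : K)) ↔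
        ∃ m : ℕ, 0 < m ∧ MvPolynomial.monomial (m • α) (1 : K) ∈ I ^ m) := by
  obtain ⟨A, rfl⟩ := hI
  have hmon : ∀ α : Fin n →₀ ℕ,
      IdealIntegral (Ideal.span ((fun α => MvPolynomial.monomial α (1 : K)) '' A))
          (MvPolynomial.monomial α (1 : K)) ↔
        ∃ m : ℕ, 0 < m ∧ MvPolynomial.monomial (m • α) (1 : K) ∈
          Ideal.span ((fun α => MvPolynomial.monomial α (1 : K)) '' A) ^ m := by
    refine fun α => ⟨fun h => h.exists_monomial_nsmul_mem, ?_⟩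
    rintro ⟨m, hm, h⟩
    refine .of_pow_mem hm ?_
    rwa [MvPolynomial.monomial_pow, one_pow]
  refine ⟨fun x => ⟨fun hx => ?_, fun hx => ?_⟩, hmon⟩
  · rw [x.as_sum]
    refine sum_mem fun α hα => ?_
    rw [← mul_one (x.coeff α), ← MvPolynomial.C_mul_monomial]
    exact Ideal.mul_mem_left _ _ (Ideal.subset_span
      ⟨α, (hmon α).mp (hx.monomial_of_mem_support MonomialOrder.lex hα), rfl⟩)
  · rw [← Ideal.mem_intClosure]
    refine Ideal.span_le.mpr ?_ hx
    rintro _ ⟨α, hα, rfl⟩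
    exact (hmon α).mpr hα
end

section
/- Let I be a monomial ideal in R = K[x_1,…,x_n] over a field K, with exponent set Γ(I) = { α ∈ ℕ^n | x^α ∈ I }. Then for α ∈ ℕ^n the following are equivalent: (1) x^α belongs to the integral closure \bar{I} of I; (2) α, viewed as a point of ℝ^n, lies in the convex hull NP(I) of Γ(I); (3) there exists a positive integer m with mα ∈ mΓ(I), where mΓ(I) denotes the m-fold sumset { γ_1 + ⋯ + γ_m | γ_i ∈ Γ(I) }. In particular Γ(\bar{I}) = NP(I) ∩ ℕ^n. -/
open MvPolynomial in
/-- Every exponent of an element of the `(j + 1)`-st power of a monomial ideal `I` is a sum of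
`j + 1` exponents of monomials of `I`. -/
theorem exists_sum_eq_of_mem_support_of_mem_pow {K σ : Type*} [Field K]
    {I : Ideal (MvPolynomial σ K)} {A : Set (σ →₀ ℕ)}
    (hI : I = Ideal.span ((fun α => monomial α (1 : K)) '' A)) (j : ℕ)
    {f : MvPolynomial σ K} (hf : f ∈ I ^ (j + 1)) {δ : σ →₀ ℕ} (hδ : δ ∈ f.support) :
    ∃ γ : Fin (j + 1) → (σ →₀ ℕ), (∀ i, monomial (γ i) (1 : K) ∈ I) ∧ δ = ∑ i, γ i := by
  induction j generalizing f δ with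
  | zero =>
    rw [zero_add, pow_one, hI, mem_ideal_span_monomial_image] at hf
    obtain ⟨β, hβ, hle⟩ := hf δ hδ
    refine ⟨fun _ => δ, fun _ => ?_, by simp⟩
    rw [hI, mem_ideal_span_monomial_image]
    intro ε hε
    rw [Finset.mem_singleton.mp (support_monomial_subset hε)]
    exact ⟨β, hβ, hle⟩
  | succ j ih =>
    classical
    rw [pow_succ] at hf
    induction hf using Submodule.mul_induction_on' generalizing δ with
    | mem_mul_mem g hg h hh =>
      obtain ⟨β, hβ, ε, hε, rfl⟩ := Finset.mem_add.mp (support_mul _ _ hδ)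
      obtain ⟨γ, hγ, rfl⟩ := ih hg hβ
      refine ⟨Fin.snoc γ ε, fun i => ?_, by simp [Fin.sum_univ_castSucc]⟩
      induction i using Fin.lastCases with
      | last =>
        rw [Fin.snoc_last]
        rw [hI, mem_ideal_span_monomial_image] at hh ⊢
        intro ζ hζ
        rw [Finset.mem_singleton.mp (support_monomial_subset hζ)]
        exact hh ε hε
      | cast i => simpa using hγ i
    | add g _ h _ ihg ihh =>
      rcases Finset.mem_union.mp (support_add hδ) with h | h
      exacts [ihg h, ihh h]

open MvPolynomial in
theorem IdealIntegral.exists_nsmul_eq_sum {K σ : Type*} [Field K]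
    {I : Ideal (MvPolynomial σ K)} {A : Set (σ →₀ ℕ)}
    (hI : I = Ideal.span ((fun α => monomial α (1 : K)) '' A)) {α : σ →₀ ℕ}
    (h : IdealIntegral I (monomial α (1 : K))) :
    ∃ m : ℕ, 0 < m ∧ ∃ γ : Fin m → (σ →₀ ℕ),
      (∀ j, monomial (γ j) (1 : K) ∈ I) ∧ m • α = ∑ j, γ j := by
  classical
  obtain ⟨m, -, a, ha, heq⟩ := h
  have hcoeff := congrArg (coeff (m • α)) heq
  rw [coeff_add, coeff_sum, monomial_pow, one_pow, coeff_monomial, if_pos rfl, coeff_zero] at hcoeff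
  have hne : ∑ j ∈ Finset.Icc 1 m, coeff (m • α) (a j * monomial α (1 : K) ^ (m - j)) ≠ 0 := by
    intro h0
    simp [h0] at hcoeff
  obtain ⟨j, hj, hjne⟩ := Finset.exists_ne_zero_of_sum_ne_zero hne
  obtain ⟨h1, hm⟩ := Finset.mem_Icc.mp hj
  rw [monomial_pow, one_pow, ← Nat.add_sub_of_le hm, add_smul, Nat.add_sub_cancel_left,
    coeff_mul_monomial, mul_one] at hjne
  obtain ⟨k, rfl⟩ := Nat.exists_eq_add_of_le' h1
  exact ⟨k + 1, k.succ_pos, exists_sum_eq_of_mem_support_of_mem_pow hI k (ha _ hj)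
    (mem_support_iff.mpr hjne)⟩

/-- A convex combination of rational points which is itself rational can be chosen with
rational positive weights. -/
theorem exists_rat_weights_of_mem_convexHull {n : ℕ} {S : Set (Fin n → ℚ)} {x : Fin n → ℚ}
    (hx : (fun i => (x i : ℝ)) ∈ convexHull ℝ ((fun y i => (y i : ℝ)) '' S)) :
    ∃ (ι : Type) (_ : Fintype ι) (z : ι → Fin n → ℚ) (q : ι → ℚ),
      (∀ i, z i ∈ S) ∧ (∀ i, 0 < q i) ∧ ∑ i, q i = 1 ∧ ∑ i, q i • z i = x := by
  obtain ⟨ι, _, z, w, hz, hind, hw, hw1, hsum⟩ := eq_pos_convex_span_of_mem_convexHull hx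
  choose y hyS hyz using fun i => hz (Set.mem_range_self i)
  obtain ⟨φ, hφ⟩ := (Algebra.linearMap ℚ ℝ).exists_leftInverse_of_injective
    (LinearMap.ker_eq_bot.mpr (algebraMap ℚ ℝ).injective)
  have hφq (r : ℚ) : φ (r : ℝ) = r := by simpa using LinearMap.congr_fun hφ r
  have hφ1 : ∑ i, φ (w i) = 1 := by
    rw [← map_sum, hw1]
    simpa using hφq 1
  have hφsum : ∑ i, φ (w i) • y i = x := by
    ext k
    have h := congrArg φ (congrFun hsum k)
    rw [hφq, Finset.sum_apply, map_sum] at h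
    rw [Finset.sum_apply, ← h]
    refine Finset.sum_congr rfl fun i _ => ?_
    rw [← hyz i, Pi.smul_apply, Pi.smul_apply, smul_eq_mul, smul_eq_mul, mul_comm (w i),
      mul_comm (φ (w i)), ← Rat.smul_def, map_smul, smul_eq_mul]
  have hφw (i : ι) : (φ (w i) : ℝ) = w i := by
    refine sub_eq_zero.mp ((affineIndependent_iff.mp hind) Finset.univ
      (fun i => (φ (w i) : ℝ) - w i) ?_ ?_ i (Finset.mem_univ i))
    · rw [Finset.sum_sub_distrib, hw1, ← Rat.cast_sum, hφ1, Rat.cast_one, sub_self]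
    · simp_rw [sub_smul]
      rw [Finset.sum_sub_distrib, hsum, sub_eq_zero]
      ext k
      rw [← hφsum]
      simp [← hyz]
  have hpos (i : ι) : 0 < φ (w i) := by
    have := hw i
    rw [← hφw i] at this
    exact_mod_cast this
  let e := Fintype.equivFin ι
  refine ⟨Fin (Fintype.card ι), inferInstance, y ∘ e.symm, fun i => φ (w (e.symm i)),
    fun i => hyS _, fun i => hpos _, ?_, ?_⟩
  · rw [← hφ1]
    exact e.symm.sum_comp (fun i => φ (w i))
  · rw [← hφsum]
    exact e.symm.sum_comp (fun i => φ (w i) • y i)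

/-- A common positive denominator for finitely many nonnegative rational numbers. -/
theorem exists_nat_mul_eq_natCast {ι : Type*} [Fintype ι] (q : ι → ℚ) (hq : ∀ i, 0 ≤ q i) :
    ∃ m : ℕ, 0 < m ∧ ∃ c : ι → ℕ, ∀ i, (c i : ℚ) = m * q i := by
  refine ⟨∏ i, (q i).den, Finset.prod_pos fun i _ => (q i).pos, ?_⟩
  choose d hd using fun i => Finset.dvd_prod_of_mem (fun i => (q i).den) (Finset.mem_univ i)
  refine ⟨fun i => d i * (q i).num.toNat, fun i => ?_⟩
  have hnum : (((q i).num.toNat : ℕ) : ℚ) = (q i).num := by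
    exact_mod_cast Int.toNat_of_nonneg (Rat.num_nonneg.mpr (hq i))
  rw [hd i, Nat.cast_mul, Nat.cast_mul, hnum, ← Rat.mul_den_eq_num (q i)]
  ring

theorem exists_nsmul_eq_sum_of_mem_convexHull {n : ℕ} {S : Set (Fin n →₀ ℕ)} {α : Fin n →₀ ℕ}
    (hα : (fun i => (α i : ℝ)) ∈ convexHull ℝ
      {x : Fin n → ℝ | ∃ γ ∈ S, x = fun i => (γ i : ℝ)}) :
    ∃ m : ℕ, 0 < m ∧ ∃ γ : Fin m → (Fin n →₀ ℕ), (∀ j, γ j ∈ S) ∧ m • α = ∑ j, γ j := by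
  have himage : {x : Fin n → ℝ | ∃ γ ∈ S, x = fun i => (γ i : ℝ)} =
      (fun (y : Fin n → ℚ) i => (y i : ℝ)) '' ((fun (γ : Fin n →₀ ℕ) i => (γ i : ℚ)) '' S) := by
    ext x
    simp [Set.image_image, eq_comm]
  rw [himage] at hα
  obtain ⟨ι, _, z, q, hz, hq, hq1, hsum⟩ :=
    exists_rat_weights_of_mem_convexHull (x := fun i => (α i : ℚ)) (by simpa using hα)
  choose g hgS hgz using hz
  obtain ⟨m, hm, c, hc⟩ := exists_nat_mul_eq_natCast q fun i => (hq i).le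
  have hcard : Fintype.card (Σ i, Fin (c i)) = m := by
    have : (∑ i, c i : ℚ) = m := by simp_rw [hc, ← Finset.mul_sum, hq1, mul_one]
    simpa using (by exact_mod_cast this : ∑ i, c i = m)
  let e := (Fintype.equivFinOfCardEq hcard).symm
  refine ⟨m, hm, fun j => g (e j).1, fun j => hgS _, ?_⟩
  rw [e.sum_comp (fun s => g s.1), Fintype.sum_sigma]
  ext k
  have hk := congrFun hsum k
  have : (m * α k : ℚ) = ∑ i, (c i : ℚ) * g i k := by
    rw [← hk, Finset.sum_apply, Finset.mul_sum]
    refine Finset.sum_congr rfl fun i _ => ?_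
    rw [hc, ← hgz i, Pi.smul_apply, smul_eq_mul, mul_assoc]
  simpa [Finsupp.finsetSum_apply] using (by exact_mod_cast this : m * α k = ∑ i, c i * g i k)

theorem mem_convexHull_of_nsmul_eq_sum {n m : ℕ} {S : Set (Fin n →₀ ℕ)} {α : Fin n →₀ ℕ}
    (hm : 0 < m) {γ : Fin m → (Fin n →₀ ℕ)} (hγ : ∀ j, γ j ∈ S) (hsum : m • α = ∑ j, γ j) :
    (fun i => (α i : ℝ)) ∈ convexHull ℝ {x : Fin n → ℝ | ∃ γ ∈ S, x = fun i => (γ i : ℝ)} := by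
  have hm' : (m : ℝ) ≠ 0 := by positivity
  have hα : (fun i => (α i : ℝ)) = ∑ j, (m : ℝ)⁻¹ • fun i => (γ j i : ℝ) := by
    ext k
    have hk : m * α k = ∑ j, γ j k := by
      simpa [Finsupp.finsetSum_apply] using DFunLike.congr_fun hsum k
    rw [← Finset.smul_sum, Pi.smul_apply, Finset.sum_apply, ← Nat.cast_sum, ← hk]
    simp [hm']
  rw [hα]
  exact (convex_convexHull ℝ _).sum_mem (fun _ _ => by positivity) (by simp [hm'])
    fun j _ => subset_convexHull ℝ _ ⟨γ j, hγ j, rfl⟩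

/-- Let `I` be a monomial ideal in `K[x_1, …, x_n]` with exponent set
`Γ(I) = {α ∈ ℕ^n | x^α ∈ I}`.  For `α ∈ ℕ^n` the following are equivalent:
(1) `x^α ∈ Ī`; (2) `α`, viewed in `ℝ^n`, lies in the convex hull `NP(I)` of `Γ(I)`;
(3) `mα ∈ mΓ(I)` for some positive integer `m`. -/
theorem monomial_in_integral_closure_iff_newton_polyhedron
    {K : Type*} [Field K] {n : ℕ}
    (I : Ideal (MvPolynomial (Fin n) K))
    -- `I` is a monomial ideal
    (hI : ∃ A : Set (Fin n →₀ ℕ),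
      I = Ideal.span ((fun α => MvPolynomial.monomial α (1 : K)) '' A))
    (α : Fin n →₀ ℕ) :
    (IdealIntegral I (MvPolynomial.monomial α (1 : K)) ↔
        (fun i => (α i : ℝ)) ∈ convexHull ℝ
          {x : Fin n → ℝ | ∃ γ : Fin n →₀ ℕ,
            MvPolynomial.monomial γ (1 : K) ∈ I ∧ x = fun i => (γ i : ℝ)}) ∧
    (IdealIntegral I (MvPolynomial.monomial α (1 : K)) ↔
        ∃ m : ℕ, 0 < m ∧ ∃ γ : Fin m → (Fin n →₀ ℕ),
          (∀ j, MvPolynomial.monomial (γ j) (1 : K) ∈ I) ∧ m • α = ∑ j, γ j) := by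
  obtain ⟨A, hA⟩ := hI
  have hint : IdealIntegral I (MvPolynomial.monomial α (1 : K)) ↔
      ∃ m : ℕ, 0 < m ∧ ∃ γ : Fin m → (Fin n →₀ ℕ),
        (∀ j, MvPolynomial.monomial (γ j) (1 : K) ∈ I) ∧ m • α = ∑ j, γ j := by
    refine ⟨IdealIntegral.exists_nsmul_eq_sum hA, ?_⟩
    rintro ⟨m, hm, γ, hγ, hsum⟩
    refine IdealIntegral.of_pow_mem hm ?_
    rw [MvPolynomial.monomial_pow, one_pow, hsum, MvPolynomial.monomial_sum_one]
    simpa using Ideal.prod_mem_prod (s := Finset.univ) (I := fun _ => I) fun j _ => hγ j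
  refine ⟨hint.trans ⟨?_, ?_⟩, hint⟩
  · rintro ⟨m, hm, γ, hγ, hsum⟩
    exact mem_convexHull_of_nsmul_eq_sum
      (S := {γ | MvPolynomial.monomial γ (1 : K) ∈ I}) hm hγ hsum
  · exact exists_nsmul_eq_sum_of_mem_convexHull (S := {γ | MvPolynomial.monomial γ (1 : K) ∈ I})
end

section
/- Let A be a subalgebra of R = K[x_1,…,x_n] generated over the field K by finitely many monomials, and let Γ(A) = { α ∈ ℕ^n | x^α ∈ A }, a submonoid of ℕ^n. Then the integral closure \bar{A} of A in R is the K-linear span of the monomials x^α with α ∈ ℕ^n such that mα ∈ Γ(A) for some positive integer m; moreover this set of exponents equals C ∩ ℕ^n, where C ⊆ ℝ^n is the cone of all nonnegative real linear combinations of elements of Γ(A). -/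
/-- A variant of Dickson's lemma: if all multiples of `β` lie in finitely many translates of a
finitely generated submonoid `Γ`, then some positive multiple of `β` lies in `Γ`. -/
theorem AddSubmonoid.exists_nsmul_mem_closure_of_forall_nsmul {G : Type*}
    [AddCommMonoid G] [IsCancelAdd G] (M F : Finset G) (β : G)
    (h : ∀ k : ℕ, ∃ f ∈ F, ∃ γ ∈ AddSubmonoid.closure (M : Set G), k • β = f + γ) :
    ∃ m : ℕ, 0 < m ∧ m • β ∈ AddSubmonoid.closure (M : Set G) := by
  choose f hf γ hγ hk using h
  have hc : ∀ k, ∃ c : M → ℕ, γ k = ∑ i, c i • (i : G) := fun k => by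
    obtain ⟨c, hc⟩ := AddSubmonoid.mem_closure_finset'.1 (hγ k)
    exact ⟨c, by rw [← hc]⟩
  choose c hc using hc
  obtain ⟨i, j, hij, hfe, hcle⟩ :=
    ((Finite.wellQuasiOrdered (α := F) (· = ·)).prod
      (wellQuasiOrdered_le (α := M → ℕ))) (fun k => (⟨f k, hf k⟩, c k))
  have hfe : f i = f j := congrArg Subtype.val hfe
  have hcle : ∀ t, c i t ≤ c j t := hcle
  refine ⟨j - i, by omega, ?_⟩
  have hsum : γ j = γ i + ∑ t, (c j t - c i t) • (t : G) := by
    rw [hc, hc, ← Finset.sum_add_distrib]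
    refine Finset.sum_congr rfl fun t _ => ?_
    rw [← add_nsmul, Nat.add_sub_cancel' (hcle t)]
  have hmul : i • β + (j - i) • β = i • β + ∑ t, (c j t - c i t) • (t : G) := by
    rw [← add_nsmul, Nat.add_sub_cancel' hij.le, hk j, hk i, ← hfe, hsum, add_assoc]
  rw [add_left_cancel hmul]
  exact _root_.sum_mem fun t _ => _root_.nsmul_mem (AddSubmonoid.subset_closure t.2) _

/-- Every finite set of positive reals is mapped into the positive rationals by some
`ℚ`-linear functional. -/
theorem Real.exists_rat_linearMap_pos (S : Finset ℝ) (hS : ∀ s ∈ S, 0 < s) :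
    ∃ φ : ℝ →ₗ[ℚ] ℚ, ∀ s ∈ S, 0 < φ s := by
  let V := Submodule.span ℚ (S : Set ℝ)
  let b := Module.finBasis ℚ V
  have hV : ∀ s : S, (s : ℝ) ∈ V := fun s => Submodule.subset_span s.2
  let U : Set (Fin (Module.finrank ℚ V) → ℝ) :=
    {t | ∀ s : S, 0 < ∑ i, ((b.repr ⟨s, hV s⟩ i : ℚ) : ℝ) * t i}
  have hU : IsOpen U := by
    simp only [U, Set.ofPred_forall]
    exact isOpen_iInter_of_finite fun s => isOpen_lt (by fun_prop) (by fun_prop)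
  have hne : U.Nonempty := by
    refine ⟨fun i => (b i : ℝ), fun s => ?_⟩
    have h := congrArg (Subtype.val : V → ℝ) (b.sum_repr ⟨s, hV s⟩)
    simp only [AddSubmonoidClass.coe_finsetSum, SetLike.val_smul, Rat.smul_def] at h
    rw [h]
    exact hS s s.2
  obtain ⟨q, hq⟩ := (DenseRange.piMap
    (fun _ : Fin (Module.finrank ℚ V) => Rat.denseRange_cast (𝕜 := ℝ))).exists_mem_open hU hne
  obtain ⟨φ, hφ⟩ := (b.constr ℚ q).exists_extend
  refine ⟨φ, fun s hs => ?_⟩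
  have h : φ s = b.constr ℚ q ⟨s, hV ⟨s, hs⟩⟩ := by rw [← hφ]; rfl
  rw [h, Module.Basis.constr_apply_fintype]
  have := hq ⟨s, hs⟩
  simp only [Pi.map_apply] at this
  simp only [Module.Basis.equivFun_apply, smul_eq_mul]
  exact_mod_cast this

theorem Rat.exists_pos_mul_eq_natCast {ι : Type*} (s : Finset ι) (q : ι → ℚ)
    (hq : ∀ i ∈ s, 0 ≤ q i) : ∃ D : ℕ, 0 < D ∧ ∀ i ∈ s, ∃ k : ℕ, (D : ℚ) * q i = k := by
  refine ⟨∏ i ∈ s, (q i).den, Finset.prod_pos fun i _ => (q i).den_pos, fun i hi => ?_⟩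
  obtain ⟨e, he⟩ := Finset.dvd_prod_of_mem (fun i => (q i).den) hi
  refine ⟨e * (q i).num.toNat, ?_⟩
  have hnum : (((q i).num.toNat : ℤ) : ℚ) = (q i).num := by
    rw [Int.toNat_of_nonneg (Rat.num_nonneg.2 (hq i hi))]
  rw [he]
  push_cast at hnum ⊢
  rw [hnum, mul_comm ((q i).den : ℚ), mul_assoc, mul_comm ((q i).den : ℚ), Rat.mul_den_eq_num]

namespace MvPolynomial

variable {σ K : Type*}

/-- The additive submonoid of exponents of the monomials lying in a subalgebra. -/
def monomialExponents [CommSemiring K] (A : Subalgebra K (MvPolynomial σ K)) :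
    AddSubmonoid (σ →₀ ℕ) where
  carrier := {γ | monomial γ (1 : K) ∈ A}
  zero_mem' := A.one_mem
  add_mem' {a b} ha hb := by
    have h := A.mul_mem ha hb
    rwa [monomial_mul, one_mul] at h

theorem mem_monomialExponents [CommSemiring K] {A : Subalgebra K (MvPolynomial σ K)}
    {γ : σ →₀ ℕ} : γ ∈ monomialExponents A ↔ monomial γ (1 : K) ∈ A :=
  Iff.rfl

theorem mem_closure_of_mem_adjoin_monomial [CommSemiring K] {M : Set (σ →₀ ℕ)}
    {p : MvPolynomial σ K} (hp : p ∈ Algebra.adjoin K ((fun α => monomial α (1 : K)) '' M))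
    {α : σ →₀ ℕ} (hα : α ∈ p.support) : α ∈ AddSubmonoid.closure M := by
  classical
  induction hp using Algebra.adjoin_induction generalizing α with
  | mem x hx =>
    obtain ⟨β, hβ, rfl⟩ := hx
    obtain rfl := Finset.mem_singleton.1 (support_monomial_subset hα)
    exact AddSubmonoid.subset_closure hβ
  | algebraMap r =>
    obtain rfl := Finset.mem_singleton.1 (support_monomial_subset hα)
    exact zero_mem _
  | add x y _ _ hx hy =>
    rcases Finset.mem_union.1 (support_add hα) with h | h
    exacts [hx h, hy h]
  | mul x y _ _ hx hy =>
    obtain ⟨a, ha, b, hb, rfl⟩ := Finset.mem_add.1 (support_mul x y hα)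
    exact add_mem (hx ha) (hy hb)

theorem closure_le_monomialExponents_adjoin [CommSemiring K] (M : Set (σ →₀ ℕ)) :
    AddSubmonoid.closure M ≤
      monomialExponents (Algebra.adjoin K ((fun α => monomial α (1 : K)) '' M)) :=
  (AddSubmonoid.closure_le).2 fun α hα => Algebra.subset_adjoin ⟨α, hα, rfl⟩

/-- A lattice point in the real cone spanned by a submonoid of `ℕ^σ` has a positive multiple in
the submonoid. -/
theorem exists_nsmul_mem_of_eq_sum_smul (Γ : AddSubmonoid (σ →₀ ℕ)) {α : σ →₀ ℕ}
    {ι : Type*} [Fintype ι] {c : ι → ℝ} {γ : ι → σ →₀ ℕ} (hc : ∀ j, 0 ≤ c j)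
    (hγ : ∀ j, γ j ∈ Γ) (h : ∀ i, (α i : ℝ) = ∑ j, c j * (γ j i : ℝ)) :
    ∃ m : ℕ, 0 < m ∧ m • α ∈ Γ := by
  classical
  obtain ⟨φ, hφ⟩ := Real.exists_rat_linearMap_pos
    (insert 1 ((Finset.univ.image c).filter (0 < ·))) (by simp +contextual)
  have hφ1 : 0 < φ 1 := hφ 1 (Finset.mem_insert_self _ _)
  have hφc : ∀ j, 0 ≤ φ (c j) := fun j => by
    rcases (hc j).eq_or_lt with h0 | h0
    · rw [← h0, map_zero]
    · exact (hφ _ (by simp [h0])).le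
  have hrat : ∀ i, φ 1 * (α i : ℚ) = ∑ j, φ (c j) * (γ j i : ℚ) := fun i => by
    have hn : ∀ (x : ℝ) (k : ℕ), φ (x * k) = φ x * k := fun x k => by
      rw [mul_comm, ← nsmul_eq_mul, map_nsmul, nsmul_eq_mul, mul_comm]
    rw [← hn, one_mul, h i, map_sum]
    exact Finset.sum_congr rfl fun j _ => hn _ _
  obtain ⟨D, hD, hk⟩ := Rat.exists_pos_mul_eq_natCast Finset.univ
    (fun o : Option ι => o.elim (φ 1) (fun j => φ (c j)))
    (by rintro (_ | j) -; exacts [hφ1.le, hφc j])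
  choose k hk using fun o => hk o (Finset.mem_univ o)
  have hk1 : (D : ℚ) * φ 1 = k none := hk none
  have hkc : ∀ j, (D : ℚ) * φ (c j) = k (some j) := fun j => hk (some j)
  refine ⟨k none, ?_, ?_⟩
  · have : (0 : ℚ) < k none := hk1 ▸ mul_pos (by exact_mod_cast hD) hφ1
    exact_mod_cast this
  · have heq : k none • α = ∑ j, k (some j) • γ j := by
      ext i
      have : (k none * α i : ℚ) = ∑ j, (k (some j) * γ j i : ℚ) := by
        rw [← hk1, mul_assoc, hrat, Finset.mul_sum]
        exact Finset.sum_congr rfl fun j _ => by rw [← hkc, mul_assoc]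
      simp only [Finsupp.smul_apply, Finsupp.finsetSum_apply, smul_eq_mul]
      exact_mod_cast this
    rw [heq]
    exact sum_mem fun j _ => nsmul_mem (hγ j) _

theorem isIntegral_monomial_of_nsmul [CommRing K] {A : Subalgebra K (MvPolynomial σ K)}
    {α : σ →₀ ℕ} {m : ℕ} (hm : 0 < m) (h : monomial (m • α) (1 : K) ∈ A) (r : K) :
    IsIntegral A (monomial α r) := by
  have h1 : IsIntegral A (monomial α (1 : K)) := by
    refine IsIntegral.of_pow hm ?_
    rw [monomial_pow, one_pow]
    exact isIntegral_algebraMap (x := (⟨_, h⟩ : A))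
  have h2 : monomial α r = algebraMap A (MvPolynomial σ K) (algebraMap K A r) * monomial α 1 := by
    rw [← IsScalarTower.algebraMap_apply, algebraMap_eq, C_mul_monomial, mul_one]
  rw [h2]
  exact isIntegral_algebraMap.mul h1

/-- The leading exponent of a polynomial integral over a monomial algebra has a positive multiple
which is an exponent of that algebra. -/
theorem exists_nsmul_degree_mem_closure [CommRing K] [IsReduced K] (mo : MonomialOrder σ)
    (M : Finset (σ →₀ ℕ)) {x : MvPolynomial σ K} (hx0 : x ≠ 0)
    (hx : IsIntegral (Algebra.adjoin K
      ((fun α => monomial α (1 : K)) '' (M : Set (σ →₀ ℕ)))) x) :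
    ∃ m : ℕ, 0 < m ∧ m • mo.degree x ∈ AddSubmonoid.closure (M : Set (σ →₀ ℕ)) := by
  classical
  obtain ⟨S, hS⟩ := hx.fg_adjoin_singleton
  refine AddSubmonoid.exists_nsmul_mem_closure_of_forall_nsmul M (S.biUnion support) _ fun k => ?_
  have hmem : x ^ k ∈ Submodule.span (Algebra.adjoin K
      ((fun α => monomial α (1 : K)) '' (M : Set (σ →₀ ℕ)))) (S : Set (MvPolynomial σ K)) := by
    rw [hS]
    exact pow_mem (Algebra.self_mem_adjoin_singleton _ x) k
  have hsupp : k • mo.degree x ∈ (x ^ k).support := by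
    rw [mem_support_iff, mo.coeff_pow_nsmul_degree]
    exact pow_ne_zero k (mo.leadingCoeff_ne_zero_iff.2 hx0)
  generalize k • mo.degree x = δ at hsupp ⊢
  generalize x ^ k = y at hmem hsupp
  induction hmem using Submodule.span_induction generalizing δ with
  | mem y hy =>
    exact ⟨δ, Finset.mem_biUnion.2 ⟨y, hy, hsupp⟩, 0, zero_mem _, (add_zero δ).symm⟩
  | zero => simp at hsupp
  | add y z _ _ hy hz =>
    rcases Finset.mem_union.1 (support_add hsupp) with h | h
    exacts [hy _ h, hz _ h]
  | smul a y _ hy =>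
    obtain ⟨u, hu, v, hv, rfl⟩ := Finset.mem_add.1 (support_mul (a : MvPolynomial σ K) y hsupp)
    obtain ⟨f, hf, γ, hγ, rfl⟩ := hy v hv
    exact ⟨f, hf, u + γ, add_mem (mem_closure_of_mem_adjoin_monomial a.2 hu) hγ,
      add_left_comm _ _ _⟩

/-- Every exponent of a polynomial integral over a monomial algebra has a positive multiple
which is an exponent of that algebra. -/
theorem exists_nsmul_mem_closure_of_isIntegral [CommRing K] [IsReduced K] (mo : MonomialOrder σ)
    (M : Finset (σ →₀ ℕ)) {x : MvPolynomial σ K}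
    (hx : IsIntegral (Algebra.adjoin K
      ((fun α => monomial α (1 : K)) '' (M : Set (σ →₀ ℕ)))) x) {α : σ →₀ ℕ}
    (hα : α ∈ x.support) :
    ∃ m : ℕ, 0 < m ∧ m • α ∈ AddSubmonoid.closure (M : Set (σ →₀ ℕ)) := by
  classical
  induction hn : x.support.card using Nat.strong_induction_on generalizing x with
  | _ N ih =>
    have hx0 : x ≠ 0 := by rintro rfl; simp at hα
    obtain ⟨m, hm, hmem⟩ := exists_nsmul_degree_mem_closure mo M hx0 hx
    by_cases hαd : α = mo.degree x
    · exact ⟨m, hm, hαd ▸ hmem⟩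
    have hsupp : (x - monomial (mo.degree x) (coeff (mo.degree x) x)).support =
        x.support.erase (mo.degree x) := by
      ext β
      by_cases h : β = mo.degree x
      · simp [h]
      · simp [h, coeff_monomial, Ne.symm h]
    refine ih _ ?_ (hx.sub (isIntegral_monomial_of_nsmul hm
      (closure_le_monomialExponents_adjoin _ hmem) (coeff (mo.degree x) x)))
      (by rw [hsupp]; exact Finset.mem_erase.2 ⟨hαd, hα⟩) rfl
    rw [hsupp, ← hn]
    exact Finset.card_erase_lt_of_mem (mo.degree_mem_support hx0)

end MvPolynomial


/-- Let `A` be a subalgebra of `R = K[x_1, …, x_n]` generated by finitely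
many monomials and let `Γ(A) = {α ∈ ℕ^n | x^α ∈ A}`.  Then the integral closure of `A`
in `R` is the `K`-linear span of the monomials `x^α` with `mα ∈ Γ(A)` for some `m ≥ 1`;
moreover this exponent set equals `pos(Γ(A)) ∩ ℕ^n`, where `pos(Γ(A)) ⊆ ℝ^n` is the set
of nonnegative real linear combinations of elements of `Γ(A)`. -/
theorem integral_closure_of_monomial_subalgebra
    {K : Type*} [Field K] {n : ℕ}
    (M : Finset (Fin n →₀ ℕ))
    (A : Subalgebra K (MvPolynomial (Fin n) K))
    -- `A` is generated by the finitely many monomials `x^α`, `α ∈ M`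
    (hA : A = Algebra.adjoin K ((fun α => MvPolynomial.monomial α (1 : K)) '' (M : Set (Fin n →₀ ℕ)))) :
    (∀ x : MvPolynomial (Fin n) K, IsIntegral A x ↔
        x ∈ Submodule.span K {p : MvPolynomial (Fin n) K | ∃ α : Fin n →₀ ℕ,
          (∃ m : ℕ, 0 < m ∧ MvPolynomial.monomial (m • α) (1 : K) ∈ A) ∧
          p = MvPolynomial.monomial α (1 : K)}) ∧
    (∀ α : Fin n →₀ ℕ,
        (∃ m : ℕ, 0 < m ∧ MvPolynomial.monomial (m • α) (1 : K) ∈ A) ↔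
        ∃ (m : ℕ) (c : Fin m → ℝ) (γ : Fin m → (Fin n →₀ ℕ)),
          (∀ j, 0 ≤ c j) ∧ (∀ j, MvPolynomial.monomial (γ j) (1 : K) ∈ A) ∧
          (fun i => (α i : ℝ)) = ∑ j, c j • (fun i => ((γ j) i : ℝ))) := by
  subst hA
  refine ⟨fun x => ⟨fun hx => ?_, fun hx => ?_⟩, fun α => ⟨?_, ?_⟩⟩
  · rw [x.as_sum]
    refine Submodule.sum_mem _ fun α hα => ?_
    obtain ⟨m, hm, hmem⟩ :=
      MvPolynomial.exists_nsmul_mem_closure_of_isIntegral MonomialOrder.lex M hx hα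
    have h : MvPolynomial.monomial α (MvPolynomial.coeff α x) =
        MvPolynomial.coeff α x • MvPolynomial.monomial α (1 : K) := by
      rw [MvPolynomial.smul_monomial, smul_eq_mul, mul_one]
    rw [h]
    exact Submodule.smul_mem _ _ (Submodule.subset_span
      ⟨α, ⟨m, hm, MvPolynomial.closure_le_monomialExponents_adjoin _ hmem⟩, rfl⟩)
  · induction hx using Submodule.span_induction with
    | mem p hp =>
      obtain ⟨α, ⟨m, hm, h⟩, rfl⟩ := hp
      exact MvPolynomial.isIntegral_monomial_of_nsmul hm h 1
    | zero => exact isIntegral_zero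
    | add p q _ _ hp hq => exact hp.add hq
    | smul r p _ hp => exact hp.smul r
  · rintro ⟨m, hm, h⟩
    refine ⟨1, fun _ => (m : ℝ)⁻¹, fun _ => m • α, fun _ => by positivity, fun _ => h, ?_⟩
    have hm0 : (m : ℝ) ≠ 0 := by exact_mod_cast hm.ne'
    ext i
    simp [hm0]
  · rintro ⟨m, c, γ, hc, hγ, h⟩
    refine MvPolynomial.exists_nsmul_mem_of_eq_sum_smul
      (MvPolynomial.monomialExponents _) hc
      (fun j => MvPolynomial.mem_monomialExponents.2 (hγ j)) fun i => ?_
    simpa using congrFun h i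
end
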